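/- arXiv:1202.5570 — 8 statements merged into one kernel-verified Lean document; each statement's English description precedes it below -/
import Mathlib

section
/- Let X be an n×n quaternionic matrix and let A belong to the symplectic group Sp(n). The following are equivalent: (i) re(tr(Xᴴ·A·W)) = 0 for every skew-Hermitian n×n quaternionic matrix W (i.e., A is a critical point of the height function h_X restricted to Sp(n)); (ii) Aᴴ·X = Xᴴ·A; (iii) X = A·Xᴴ·A. -/
open scoped Quaternion Matrix

theorem Quaternion.re_finset_sum {ι : Type*} (s : Finset ι) (f : ι → ℍ[ℝ]) :
    (∑ i ∈ s, f i).re = ∑ i ∈ s, (f i).re :=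
  map_sum (QuaternionAlgebra.reₗ _ _ _) f s

namespace Matrix

variable {m n : Type*} [Fintype m] [Fintype n]

theorem re_trace_mul_comm_quaternion (M : Matrix m n ℍ[ℝ]) (N : Matrix n m ℍ[ℝ]) :
    (M * N).trace.re = (N * M).trace.re := by
  simp only [trace, diag_apply, mul_apply, Quaternion.re_finset_sum]
  rw [Finset.sum_comm]
  refine Finset.sum_congr rfl fun i _ => Finset.sum_congr rfl fun j _ => ?_
  rw [Quaternion.re_mul, Quaternion.re_mul]
  ring

theorem re_trace_conjTranspose_quaternion (M : Matrix n n ℍ[ℝ]) :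
    Mᴴ.trace.re = M.trace.re := by
  rw [trace_conjTranspose, Quaternion.re_star]

theorem re_trace_conjTranspose_mul_self_quaternion (S : Matrix m n ℍ[ℝ]) :
    (Sᴴ * S).trace.re = ∑ i, ∑ j, Quaternion.normSq (S j i) := by
  simp only [trace, diag_apply, mul_apply, conjTranspose_apply, Quaternion.star_mul_self,
    Quaternion.re_finset_sum, Quaternion.re_coe]

theorem eq_zero_of_re_trace_conjTranspose_mul_self_quaternion {S : Matrix m n ℍ[ℝ]}
    (h : (Sᴴ * S).trace.re = 0) : S = 0 := by
  rw [re_trace_conjTranspose_mul_self_quaternion, Finset.sum_eq_zero_iff_of_nonneg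
    fun i _ => Finset.sum_nonneg fun j _ => Quaternion.normSq_nonneg] at h
  ext1 j i
  have hi := h i (Finset.mem_univ i)
  rw [Finset.sum_eq_zero_iff_of_nonneg fun j _ => Quaternion.normSq_nonneg] at hi
  exact Quaternion.normSq_eq_zero.mp (hi j (Finset.mem_univ j))

theorem re_trace_conjTranspose_mul_of_conjTranspose_eq_neg {M W : Matrix n n ℍ[ℝ]}
    (hW : Wᴴ = -W) : (Mᴴ * W).trace.re = -(M * W).trace.re := by
  rw [← re_trace_conjTranspose_quaternion, conjTranspose_mul, conjTranspose_conjTranspose, hW,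
    Matrix.neg_mul, trace_neg, Quaternion.re_neg, re_trace_mul_comm_quaternion]

theorem forall_re_trace_mul_eq_zero_iff_isHermitian (M : Matrix n n ℍ[ℝ]) :
    (∀ W : Matrix n n ℍ[ℝ], Wᴴ = -W → (M * W).trace.re = 0) ↔ M.IsHermitian := by
  constructor
  · intro h
    have hS : (M - Mᴴ)ᴴ = -(M - Mᴴ) := by simp
    have hM := h _ hS
    have hM' := re_trace_conjTranspose_mul_of_conjTranspose_eq_neg (M := M) hS
    refine (sub_eq_zero.mp (eq_zero_of_re_trace_conjTranspose_mul_self_quaternion ?_)).symm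
    rw [hS, Matrix.neg_mul, Matrix.sub_mul, trace_neg, trace_sub, Quaternion.re_neg,
      Quaternion.re_sub, hM', hM]
    simp
  · intro h W hW
    have hM := re_trace_conjTranspose_mul_of_conjTranspose_eq_neg (M := M) hW
    rw [h.eq] at hM
    linarith

end Matrix

theorem criticalPoint_heightFunction_tfae (n : ℕ) (X A : Matrix (Fin n) (Fin n) ℍ[ℝ])
    (hA : A * Aᴴ = 1) :
    ((∀ W : Matrix (Fin n) (Fin n) ℍ[ℝ], Wᴴ = -W → ((Xᴴ * A * W).trace).re = 0) ↔
      Aᴴ * X = Xᴴ * A) ∧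
    (Aᴴ * X = Xᴴ * A ↔ X = A * Xᴴ * A) := by
  have hA' : Aᴴ * A = 1 := mul_eq_one_comm.mp hA
  refine ⟨?_, fun h => ?_, fun h => ?_⟩
  · rw [Matrix.forall_re_trace_mul_eq_zero_iff_isHermitian, Matrix.IsHermitian,
      Matrix.conjTranspose_mul, Matrix.conjTranspose_conjTranspose]
  · rw [Matrix.mul_assoc, ← h, ← Matrix.mul_assoc, hA, Matrix.one_mul]
  · calc Aᴴ * X = Aᴴ * (A * Xᴴ * A) := congrArg _ h
      _ = Xᴴ * A := by simp only [← Matrix.mul_assoc, hA', Matrix.one_mul]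
end

section
/- Let X = U·D·Vᴴ where U and V belong to Sp(n) and D is any n×n quaternionic matrix (e.g., the singular value decomposition of X), and let A ∈ Sp(n). Set B = Uᴴ·A·V. Then: (1) h_X(A) = h_D(B), i.e., re(tr(Xᴴ·A)) = re(tr(Dᴴ·B)); and (2) A is a critical point of h_X if and only if B is a critical point of h_D, i.e., Aᴴ·X = Xᴴ·A if and only if Bᴴ·D = Dᴴ·B. Hence the study of critical sets of arbitrary height functions reduces to height functions with diagonal nonnegative real X. -/
open scoped Quaternion Matrix

/-- The real part of the trace of a product of quaternionic matrices is cyclic, although the trace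
itself is not. -/
theorem re_trace_mul_comm {m n : Type*} [Fintype m] [Fintype n]
    (M : Matrix m n ℍ[ℝ]) (N : Matrix n m ℍ[ℝ]) :
    ((M * N).trace).re = ((N * M).trace).re := by
  simp only [Matrix.trace, Matrix.diag_apply, Matrix.mul_apply, Quaternion.re_finset_sum]
  rw [Finset.sum_comm]
  refine Finset.sum_congr rfl fun i _ => Finset.sum_congr rfl fun j _ => ?_
  simp only [Quaternion.re_mul]
  ring

theorem heightFunction_svd_reduction (n : ℕ) (X U D V A B : Matrix (Fin n) (Fin n) ℍ[ℝ])
    (hU : U * Uᴴ = 1) (hV : V * Vᴴ = 1) (hA : A * Aᴴ = 1)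
    (hX : X = U * D * Vᴴ) (hB : B = Uᴴ * A * V) :
    ((Xᴴ * A).trace).re = ((Dᴴ * B).trace).re ∧
    (Aᴴ * X = Xᴴ * A ↔ Bᴴ * D = Dᴴ * B) := by
  have hV' : Vᴴ * V = 1 := mul_eq_one_comm.mp hV
  have hXA : Vᴴ * (Xᴴ * A) * V = Dᴴ * B := by
    simp only [hX, hB, Matrix.conjTranspose_mul, Matrix.conjTranspose_conjTranspose,
      ← Matrix.mul_assoc, hV', Matrix.one_mul]
  have hAX : Vᴴ * (Aᴴ * X) * V = Bᴴ * D := by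
    simp only [hX, hB, Matrix.conjTranspose_mul, Matrix.conjTranspose_conjTranspose,
      Matrix.mul_assoc, hV', Matrix.mul_one]
  have conj_cancel (M : Matrix (Fin n) (Fin n) ℍ[ℝ]) : V * (Vᴴ * M * V) * Vᴴ = M := by
    rw [Matrix.mul_assoc Vᴴ, ← Matrix.mul_assoc V, hV, Matrix.one_mul, Matrix.mul_assoc, hV,
      Matrix.mul_one]
  refine ⟨?_, ?_⟩
  · rw [← hXA, re_trace_mul_comm _ V, ← Matrix.mul_assoc, hV, Matrix.one_mul]
  · rw [← hXA, ← hAX]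
    refine ⟨fun h => by rw [h], fun h => ?_⟩
    rw [← conj_cancel (Aᴴ * X), h, conj_cancel]
end

section
/- (Structure theorem for the critical set.) Let d : Fin n → ℝ be a function with nonnegative values and let D be the n×n quaternionic diagonal matrix with real diagonal entries d(1), …, d(n). Let A ∈ Sp(n). Then A is a critical point of the height function h_D (i.e., Aᴴ·D = D·A) if and only if: (a) A is block diagonal with respect to the level sets of d, i.e., A(j,k) = 0 whenever d(j) ≠ d(k); and (b) on each block corresponding to a nonzero value of d, A is Hermitian, i.e., star(A(k,j)) = A(j,k) whenever d(j) = d(k) ≠ 0. (On the block where d = 0 the matrix A is an arbitrary unitary block, and each Hermitian unitary block squares to the identity.) -/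
open scoped Quaternion Matrix

theorem conjTranspose_mul_diagonal_eq_iff {n : ℕ} (d : Fin n → ℝ)
    (A : Matrix (Fin n) (Fin n) ℍ[ℝ]) :
    (Aᴴ * Matrix.diagonal fun i => ((d i : ℝ) : ℍ[ℝ])) =
        (Matrix.diagonal fun i => ((d i : ℝ) : ℍ[ℝ])) * A ↔
      ∀ j k, d k • star (A k j) = d j • A j k := by
  simp only [← Matrix.ext_iff, Matrix.mul_diagonal, Matrix.diagonal_mul,
    Matrix.conjTranspose_apply, Quaternion.coe_mul_eq_smul, Quaternion.mul_coe_eq_smul]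

/-- A critical point of the height function of `D` commutes with `D * D`. -/
theorem mul_self_mul_eq_of_conjTranspose_mul_eq {n : ℕ} {A D : Matrix (Fin n) (Fin n) ℍ[ℝ]}
    (hA : A * Aᴴ = 1) (h : Aᴴ * D = D * A) : D * D * A = A * (D * D) := by
  have h₁ : A * D = D * Aᴴ := by
    calc A * D = A * (D * A) * Aᴴ := by simp only [Matrix.mul_assoc, hA, Matrix.mul_one]
      _ = D * Aᴴ := by rw [← h, ← Matrix.mul_assoc, hA, Matrix.one_mul]
  rw [Matrix.mul_assoc, ← h, ← Matrix.mul_assoc, ← h₁, Matrix.mul_assoc]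

theorem criticalSet_structure_diagonal_height (n : ℕ) (d : Fin n → ℝ) (hd : ∀ i, 0 ≤ d i)
    (D : Matrix (Fin n) (Fin n) ℍ[ℝ]) (hD : D = Matrix.diagonal fun i => ((d i : ℝ) : ℍ[ℝ]))
    (A : Matrix (Fin n) (Fin n) ℍ[ℝ]) (hA : A * Aᴴ = 1) :
    Aᴴ * D = D * A ↔
      ((∀ j k, d j ≠ d k → A j k = 0) ∧
       (∀ j k, d j = d k → d j ≠ 0 → star (A k j) = A j k)) := by
  constructor
  · intro h
    have hcomm := mul_self_mul_eq_of_conjTranspose_mul_eq hA h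
    rw [hD, conjTranspose_mul_diagonal_eq_iff] at h
    refine ⟨fun j k hjk => ?_, fun j k hjk hj => ?_⟩
    · have hjk' := congrFun (congrFun hcomm j) k
      rw [hD, Matrix.mul_assoc, ← Matrix.mul_assoc A] at hjk'
      simp only [Matrix.diagonal_mul, Matrix.mul_diagonal,
        Quaternion.coe_mul_eq_smul, Quaternion.mul_coe_eq_smul, smul_smul] at hjk'
      rw [← sub_eq_zero, ← sub_smul, smul_eq_zero, sub_eq_zero] at hjk'
      exact hjk'.resolve_left fun e => hjk ((mul_self_inj (hd j) (hd k)).1 e)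
    · have hjk' := h j k
      rw [← hjk] at hjk'
      exact smul_right_injective _ hj hjk'
  · rintro ⟨hblock, hherm⟩
    rw [hD, conjTranspose_mul_diagonal_eq_iff]
    intro j k
    by_cases hjk : d j = d k
    · by_cases hj : d j = 0
      · rw [← hjk, hj, zero_smul, zero_smul]
      · rw [hherm j k hjk hj, hjk]
    · rw [hblock j k hjk, hblock k j (Ne.symm hjk), star_zero, smul_zero, smul_zero]
end

section
/- Let t be a nonzero real number and A ∈ Sp(n). Then A is a critical point of the height function h_{tI} (i.e., Aᴴ·(tI) = (tI)·A) if and only if A is Hermitian (Aᴴ = A), if and only if A is an involution (A² = I). Hence the critical set of the invariant height function h_I on Sp(n) is exactly the set of unitary involutions. -/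
open scoped Quaternion Matrix

theorem criticalPoint_scalar_height_iff (n : ℕ) (t : ℝ) (ht : t ≠ 0)
    (A : Matrix (Fin n) (Fin n) ℍ[ℝ]) (hA : A * Aᴴ = 1) :
    (Aᴴ * (t • (1 : Matrix (Fin n) (Fin n) ℍ[ℝ])) = (t • (1 : Matrix (Fin n) (Fin n) ℍ[ℝ])) * A ↔
      Aᴴ = A) ∧
    (Aᴴ = A ↔ A * A = 1) := by
  refine ⟨?_, fun h => ?_, fun h => ?_⟩
  · rw [Matrix.mul_smul, Matrix.smul_mul, Matrix.mul_one, Matrix.one_mul]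
    exact smul_right_inj ht
  · rwa [h] at hA
  · calc Aᴴ = A * A * Aᴴ := by rw [h, Matrix.one_mul]
      _ = A := by rw [Matrix.mul_assoc, hA, Matrix.mul_one]
end

section
/- Let d : Fin n → ℝ take pairwise distinct strictly positive values (for example d(i) = i, giving the Morse height function), and let D be the corresponding n×n real diagonal matrix. Then A ∈ Sp(n) is a critical point of h_D (i.e., Aᴴ·D = D·A) if and only if A is a diagonal matrix whose diagonal entries all lie in {−1, +1} (as quaternions). In particular h_D has exactly 2^n critical points. -/
open scoped Quaternion Matrix

/-- A matrix commuting with a real diagonal matrix with distinct entries is diagonal. -/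
theorem apply_eq_zero_of_commute_diagonal {n : ℕ} {e : Fin n → ℝ} (he : Function.Injective e)
    {H : Matrix (Fin n) (Fin n) ℍ[ℝ]}
    (h : H * Matrix.diagonal (fun i => ((e i : ℝ) : ℍ[ℝ])) =
      Matrix.diagonal (fun i => ((e i : ℝ) : ℍ[ℝ])) * H)
    {i j : Fin n} (hij : i ≠ j) : H i j = 0 := by
  have h1 := congrFun (congrFun h i) j
  rw [Matrix.mul_diagonal, Matrix.diagonal_mul, ← Quaternion.coe_commutes,
    ← sub_eq_zero, ← sub_mul, ← Quaternion.coe_sub] at h1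
  rcases mul_eq_zero.mp h1 with h2 | h2
  · have h3 : e j - e i = 0 := Quaternion.coe_injective (h2.trans Quaternion.coe_zero.symm)
    exact absurd (he (sub_eq_zero.mp h3)).symm hij
  · exact h2

theorem critical_iff_diagonal_signs {n : ℕ} {d : Fin n → ℝ} (hpos : ∀ i, 0 < d i)
    (hinj : Function.Injective d) {A : Matrix (Fin n) (Fin n) ℍ[ℝ]} (hA : A * Aᴴ = 1) :
    Aᴴ * Matrix.diagonal (fun i => ((d i : ℝ) : ℍ[ℝ])) =
        Matrix.diagonal (fun i => ((d i : ℝ) : ℍ[ℝ])) * A ↔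
      ∃ ε : Fin n → ℍ[ℝ], (∀ i, ε i = 1 ∨ ε i = -1) ∧ A = Matrix.diagonal ε := by
  constructor
  · intro h
    set D : Matrix (Fin n) (Fin n) ℍ[ℝ] := Matrix.diagonal (fun i => ((d i : ℝ) : ℍ[ℝ])) with hD
    have hd : ∀ i, ((d i : ℝ) : ℍ[ℝ]) ≠ 0 := fun i hi =>
      (hpos i).ne' (Quaternion.coe_injective (hi.trans Quaternion.coe_zero.symm))
    have hsq : (D * A) * (D * A) = D * D := by
      calc (D * A) * (D * A) = (D * A) * (Aᴴ * D) := by rw [h]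
        _ = D * (A * Aᴴ) * D := by simp only [Matrix.mul_assoc]
        _ = D * D := by rw [hA, Matrix.mul_one]
    have hDD : D * D = Matrix.diagonal (fun i => ((d i * d i : ℝ) : ℍ[ℝ])) := by
      simp [hD, Matrix.diagonal_mul_diagonal]
    have hcomm : (D * A) * (D * D) = (D * D) * (D * A) := by
      rw [← hsq, Matrix.mul_assoc (D * A)]
    have hinj2 : Function.Injective fun i => d i * d i := fun i j hij =>
      hinj ((mul_self_inj (hpos i).le (hpos j).le).mp hij)
    rw [hDD] at hcomm
    have hoff : ∀ i j, i ≠ j → A i j = 0 := fun i j hij => by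
      have h0 := apply_eq_zero_of_commute_diagonal hinj2 hcomm hij
      rw [hD, Matrix.diagonal_mul] at h0
      exact (mul_eq_zero.mp h0).resolve_left (hd i)
    have hdiag : A = Matrix.diagonal fun i => A i i := by
      ext1 i j
      by_cases hij : i = j
      · subst hij; simp
      · rw [Matrix.diagonal_apply_ne _ hij, hoff i j hij]
    refine ⟨fun i => A i i, fun i => ?_, hdiag⟩
    have h1 := congrFun (congrFun hsq i) i
    rw [hdiag, hD] at h1
    simp only [Matrix.diagonal_mul_diagonal, Matrix.diagonal_apply_eq] at h1
    rw [mul_assoc, ← mul_assoc (A i i), ← Quaternion.coe_commutes, mul_assoc] at h1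
    have h2 := mul_left_cancel₀ (hd i) h1
    exact mul_self_eq_one_iff.mp (mul_left_cancel₀ (hd i) (h2.trans (mul_one _).symm))
  · rintro ⟨ε, hε, rfl⟩
    rw [Matrix.diagonal_conjTranspose, Matrix.diagonal_mul_diagonal, Matrix.diagonal_mul_diagonal]
    congr 1
    funext i
    rcases hε i with h | h <;> simp [h]

theorem ncard_diagonal_signs (n : ℕ) :
    {A : Matrix (Fin n) (Fin n) ℍ[ℝ] |
      ∃ ε : Fin n → ℍ[ℝ], (∀ i, ε i = 1 ∨ ε i = -1) ∧ A = Matrix.diagonal ε}.ncard = 2 ^ n := by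
  classical
  have hne : (1 : ℍ[ℝ]) ≠ -1 := fun h => by
    have := congrArg QuaternionAlgebra.re h
    norm_num at this
  have hset : {A : Matrix (Fin n) (Fin n) ℍ[ℝ] |
      ∃ ε : Fin n → ℍ[ℝ], (∀ i, ε i = 1 ∨ ε i = -1) ∧ A = Matrix.diagonal ε} =
      Matrix.diagonal '' (Fintype.piFinset fun _ : Fin n => ({1, -1} : Finset ℍ[ℝ]) :
        Set (Fin n → ℍ[ℝ])) := by
    ext A
    simp [Set.mem_pi, eq_comm]
  rw [hset, Set.ncard_image_of_injective _ Matrix.diagonal_injective, Set.ncard_coe_finset,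
    Fintype.card_piFinset]
  simp [Finset.card_pair hne]

theorem criticalSet_morse_height (n : ℕ) (d : Fin n → ℝ) (hpos : ∀ i, 0 < d i)
    (hinj : Function.Injective d)
    (D : Matrix (Fin n) (Fin n) ℍ[ℝ]) (hD : D = Matrix.diagonal fun i => ((d i : ℝ) : ℍ[ℝ])) :
    (∀ A : Matrix (Fin n) (Fin n) ℍ[ℝ], A * Aᴴ = 1 →
      (Aᴴ * D = D * A ↔
        ∃ ε : Fin n → ℍ[ℝ], (∀ i, ε i = 1 ∨ ε i = -1) ∧ A = Matrix.diagonal ε)) ∧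
    {A : Matrix (Fin n) (Fin n) ℍ[ℝ] | A * Aᴴ = 1 ∧ Aᴴ * D = D * A}.ncard = 2 ^ n := by
  subst hD
  refine ⟨fun A hA => critical_iff_diagonal_signs hpos hinj hA, ?_⟩
  rw [← ncard_diagonal_signs n]
  congr 1
  ext A
  refine ⟨fun h => (critical_iff_diagonal_signs hpos hinj h.1).mp h.2, fun h => ?_⟩
  have hA : A * Aᴴ = 1 := by
    obtain ⟨ε, hε, rfl⟩ := h
    rw [Matrix.diagonal_conjTranspose, Matrix.diagonal_mul_diagonal, ← Matrix.diagonal_one]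
    congr 1
    funext i
    rcases hε i with h | h <;> simp [h]
  exact ⟨hA, (critical_iff_diagonal_signs hpos hinj hA).mpr h⟩
end

section
/- Every unitary involution is conjugate in Sp(n) to a real diagonal sign matrix: if A ∈ Sp(n) satisfies A² = I, then there exist U ∈ Sp(n) and a natural number q ≤ n such that Uᴴ·A·U is the diagonal matrix whose first q diagonal entries are −1 and whose remaining n − q diagonal entries are +1. -/
open scoped Quaternion Matrix

namespace QuaternionicMatrix

/-- The sign attached to a Boolean: `false` gives `-1` and `true` gives `1`. -/
def sign (b : Bool) : ℍ[ℝ] := if b then 1 else -1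

lemma star_sign (b : Bool) : star (sign b) = sign b := by
  cases b <;> simp [sign]

lemma diagonal_sign_true {ι : Type*} [DecidableEq ι] :
    Matrix.diagonal (fun _ : ι => sign true) = 1 := by
  simp [sign]

lemma diagonal_sign_false {ι : Type*} [DecidableEq ι] :
    Matrix.diagonal (fun _ : ι => sign false) = -1 := by
  simp [sign, ← Matrix.diagonal_one, Matrix.diagonal_neg]

variable {m ι : Type*} [Fintype m] [Fintype ι]

lemma re_sum {α : Type*} (s : Finset α) (f : α → ℍ[ℝ]) :
    (∑ i ∈ s, f i).re = ∑ i ∈ s, (f i).re :=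
  map_sum (AddMonoidHom.mk' (fun q : ℍ[ℝ] => q.re) (fun _ _ => rfl)) f s

lemma re_trace_mul_comm (M : Matrix m ι ℍ[ℝ]) (N : Matrix ι m ℍ[ℝ]) :
    (M * N).trace.re = (N * M).trace.re := by
  simp only [Matrix.trace, Matrix.diag_apply, Matrix.mul_apply, re_sum]
  rw [Finset.sum_comm]
  refine Finset.sum_congr rfl fun i _ => Finset.sum_congr rfl fun j _ => ?_
  simp only [Quaternion.re_mul]
  ring

variable [DecidableEq m] [DecidableEq ι]

lemma one_sub_mul_conjTranspose_ne_zero {V : Matrix m ι ℍ[ℝ]} (hV : Vᴴ * V = 1)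
    (hcard : Fintype.card ι < Fintype.card m) : 1 - V * Vᴴ ≠ 0 := by
  intro h
  have key := re_trace_mul_comm V Vᴴ
  rw [hV, ← sub_eq_zero.mp h, Matrix.trace_one, Matrix.trace_one] at key
  simp only [Quaternion.re_natCast, Nat.cast_inj] at key
  omega

/-- Some real multiple of a nonzero column of `M` is a unit vector. -/
lemma exists_normalized_column {M : Matrix m m ℍ[ℝ]} (hM : M ≠ 0) :
    ∃ x : Matrix m (Fin 1) ℍ[ℝ], (M * x)ᴴ * (M * x) = 1 := by
  obtain ⟨i₀, j, hij⟩ : ∃ i j, M i j ≠ 0 := by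
    by_contra! h
    exact hM (Matrix.ext h)
  set r : ℝ := ∑ i, Quaternion.normSq (M i j) with hr
  have hpos : 0 < r := Finset.sum_pos' (fun i _ => Quaternion.normSq_nonneg)
    ⟨i₀, Finset.mem_univ _, lt_of_le_of_ne Quaternion.normSq_nonneg
      (Ne.symm (Quaternion.normSq_ne_zero.mpr hij))⟩
  refine ⟨(√r)⁻¹ • Matrix.replicateCol (Fin 1) (Pi.single j (1 : ℍ[ℝ])), ?_⟩
  have hcol : M * Matrix.replicateCol (Fin 1) (Pi.single j (1 : ℍ[ℝ])) =
      Matrix.replicateCol (Fin 1) (fun i => M i j) := by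
    ext1 i u
    simp [Matrix.mul_apply, Pi.single_apply]
  rw [Matrix.mul_smul, hcol]
  ext1 u v
  have hsum : ∑ i, star (M i j) * M i j = (r : ℍ[ℝ]) := by
    simp only [Quaternion.star_mul_self, hr]
    exact (map_sum (algebraMap ℝ ℍ[ℝ]) _ _).symm
  have hsq : (√r)⁻¹ * (√r)⁻¹ * r = 1 := by
    rw [← mul_inv, Real.mul_self_sqrt hpos.le, inv_mul_cancel₀ hpos.ne']
  have hone : (1 : Matrix (Fin 1) (Fin 1) ℍ[ℝ]) u v = 1 := by
    rw [Subsingleton.elim u v, Matrix.one_apply_eq]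
  have : StarModule ℝ ℍ[ℝ] := ⟨fun s a => by simp [Quaternion.star_smul]⟩
  rw [hone, Matrix.conjTranspose_smul, star_trivial, Matrix.smul_mul, Matrix.mul_smul, smul_smul]
  simp only [Matrix.smul_apply, Matrix.mul_apply, Matrix.conjTranspose_apply,
    Matrix.replicateCol_apply, hsum]
  rw [← Quaternion.coe_mul_eq_smul, ← Quaternion.coe_mul, hsq]
  simp

lemma exists_orthogonal_eigenvector {A : Matrix m m ℍ[ℝ]} (hA : Aᴴ = A) (hinv : A * A = 1)
    {V : Matrix m ι ℍ[ℝ]} (hV : Vᴴ * V = 1) {d : ι → Bool}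
    (hAV : A * V = V * Matrix.diagonal (fun i => sign (d i)))
    (hcard : Fintype.card ι < Fintype.card m) :
    ∃ (w : Matrix m (Fin 1) ℍ[ℝ]) (b : Bool), wᴴ * w = 1 ∧ Vᴴ * w = 0 ∧
      A * w = w * Matrix.diagonal (fun _ => sign b) := by
  have hVA : Vᴴ * A = Matrix.diagonal (fun i => sign (d i)) * Vᴴ := by
    have := congrArg Matrix.conjTranspose hAV
    simpa [Matrix.conjTranspose_mul, hA, Matrix.diagonal_conjTranspose, Pi.star_def,
      star_sign] using this
  set P := 1 - V * Vᴴ with hP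
  have hVP : Vᴴ * P = 0 := by
    rw [hP, Matrix.mul_sub, ← Matrix.mul_assoc, hV]
    simp
  have hVAP : Vᴴ * (A * P) = 0 := by
    rw [← Matrix.mul_assoc, hVA, Matrix.mul_assoc, hVP, Matrix.mul_zero]
  by_cases h : P + A * P = 0
  · have hne : P - A * P ≠ 0 := by
      intro h'
      refine one_sub_mul_conjTranspose_ne_zero hV hcard ?_
      have h2 : (2 : ℝ) • P = 0 := by
        rw [two_smul]
        nth_rw 2 [sub_eq_zero.mp h']
        exact h
      exact (smul_eq_zero.mp h2).resolve_left two_ne_zero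
    obtain ⟨x, hx⟩ := exists_normalized_column hne
    refine ⟨_, false, hx, ?_, ?_⟩
    · rw [← Matrix.mul_assoc, Matrix.mul_sub, hVP, hVAP]
      simp
    · rw [← Matrix.mul_assoc, Matrix.mul_sub, ← Matrix.mul_assoc A A, hinv]
      rw [diagonal_sign_false, Matrix.one_mul, ← neg_sub, Matrix.neg_mul]
      exact ((Matrix.mul_neg _ _).trans (congrArg Neg.neg (Matrix.mul_one _))).symm
  · obtain ⟨x, hx⟩ := exists_normalized_column h
    refine ⟨_, true, hx, ?_, ?_⟩
    · rw [← Matrix.mul_assoc, Matrix.mul_add, hVP, hVAP]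
      simp
    · rw [← Matrix.mul_assoc, Matrix.mul_add, ← Matrix.mul_assoc A A, hinv]
      rw [diagonal_sign_true, Matrix.one_mul, add_comm]
      exact (Matrix.mul_one _).symm

lemma exists_orthonormal_eigenvectors {A : Matrix m m ℍ[ℝ]} (hA : Aᴴ = A) (hinv : A * A = 1)
    (k : ℕ) (hk : k ≤ Fintype.card m) :
    ∃ (V : Matrix m (Fin k) ℍ[ℝ]) (d : Fin k → Bool), Vᴴ * V = 1 ∧
      A * V = V * Matrix.diagonal (fun i => sign (d i)) := by
  induction k with
  | zero => exact ⟨0, fun _ => true, Subsingleton.elim _ _, Subsingleton.elim _ _⟩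
  | succ k ih =>
    obtain ⟨V, d, hV, hAV⟩ := ih (by omega)
    obtain ⟨w, b, hw, hVw, hAw⟩ :=
      exists_orthogonal_eigenvector hA hinv hV hAV (by simpa using hk)
    have hwV : wᴴ * V = 0 := by
      simpa [Matrix.conjTranspose_mul] using congrArg Matrix.conjTranspose hVw
    let e : Fin (k + 1) ≃ Fin k ⊕ Fin 1 := finSumFinEquiv.symm
    let W := Matrix.fromCols V w
    let c : Fin k ⊕ Fin 1 → Bool := Sum.elim d (fun _ => b)
    have hW : Wᴴ * W = 1 := by
      simp only [W, Matrix.conjTranspose_fromCols_eq_fromRows_conjTranspose,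
        Matrix.fromRows_mul_fromCols, hV, hVw, hwV, hw, Matrix.fromBlocks_one]
    have hAW : A * W = W * Matrix.diagonal (fun i => sign (c i)) := by
      have hc : (Matrix.diagonal fun i => sign (c i)) =
          Matrix.fromBlocks (Matrix.diagonal fun i => sign (d i)) 0 0
            (Matrix.diagonal fun _ => sign b) := by
        rw [Matrix.fromBlocks_diagonal]
        congr 1
        ext1 i
        cases i <;> rfl
      rw [hc, Matrix.mul_fromCols, Matrix.fromCols_mul_fromBlocks, hAV, hAw]
      simp only [Matrix.mul_zero, add_zero, zero_add]
      rfl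
    refine ⟨W.submatrix id e, c ∘ e, ?_, ?_⟩
    · rw [Matrix.conjTranspose_submatrix, ← Matrix.submatrix_mul _ _ e id e Function.bijective_id,
        hW, Matrix.submatrix_one_equiv]
    · have h := congrArg (fun M => M.submatrix id e) hAW
      rwa [Matrix.submatrix_mul _ _ id id e Function.bijective_id,
        Matrix.submatrix_mul _ _ id e e e.bijective, Matrix.submatrix_diagonal_equiv] at h

end QuaternionicMatrix

lemma Monotone.exists_eq_false_iff_lt {n : ℕ} {f : Fin n → Bool} (hf : Monotone f) :
    ∃ q ≤ n, ∀ i, f i = false ↔ (i : ℕ) < q := by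
  classical
  have hex : ∃ q, ∀ i : Fin n, q ≤ (i : ℕ) → f i = true :=
    ⟨n, fun i hi => absurd i.isLt (by omega)⟩
  refine ⟨Nat.find hex, Nat.find_min' hex fun i hi => absurd i.isLt (by omega), fun i => ?_⟩
  constructor
  · intro hi
    by_contra! hq
    simp [Nat.find_spec hex i hq] at hi
  · intro hi
    have := Nat.find_min hex hi
    push Not at this
    obtain ⟨j, hij, hj⟩ := this
    exact Bool.eq_false_of_le_false ((hf (show i ≤ j from hij)).trans_eq (by simpa using hj))

open QuaternionicMatrix in
theorem unitary_involution_conjugate_to_sign_diagonal (n : ℕ)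
    (A : Matrix (Fin n) (Fin n) ℍ[ℝ]) (hA : A * Aᴴ = 1) (hinv : A * A = 1) :
    ∃ (U : Matrix (Fin n) (Fin n) ℍ[ℝ]) (q : ℕ), q ≤ n ∧ U * Uᴴ = 1 ∧
      Uᴴ * A * U =
        Matrix.diagonal (fun i : Fin n => if (i : ℕ) < q then (-1 : ℍ[ℝ]) else 1) := by
  have hherm : Aᴴ = A := by
    rw [← Matrix.one_mul Aᴴ, ← hinv, Matrix.mul_assoc, hA, Matrix.mul_one]
  obtain ⟨V, d, hV, hAV⟩ := exists_orthonormal_eigenvectors hherm hinv n (by simp)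
  obtain ⟨q, hq, hlt⟩ := (Tuple.monotone_sort d).exists_eq_false_iff_lt
  set σ := Tuple.sort d
  refine ⟨V.submatrix id σ, q, hq, ?_, ?_⟩
  · rw [Matrix.conjTranspose_submatrix, ← Matrix.submatrix_mul _ _ id σ id σ.bijective,
      mul_eq_one_comm.mp hV, Matrix.submatrix_id_id]
  · have hD : Vᴴ * A * V = Matrix.diagonal (fun i => sign (d i)) := by
      rw [Matrix.mul_assoc, hAV, ← Matrix.mul_assoc, hV, Matrix.one_mul]
    have hperm := congrArg (fun M => M.submatrix σ σ) hD
    simp only [Matrix.submatrix_mul _ _ σ id σ Function.bijective_id,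
      Matrix.submatrix_mul _ _ σ id id Function.bijective_id, Matrix.submatrix_id_id,
      Matrix.submatrix_diagonal_equiv] at hperm
    rw [Matrix.conjTranspose_submatrix, hperm]
    congr 1
    ext1 i
    by_cases hi : (i : ℕ) < q
    · have hdi : d (σ i) = false := (hlt i).mpr hi
      simp [sign, hi, hdi]
    · have hdi : d (σ i) = true := by simpa using mt (hlt i).mp hi
      simp [sign, hi, hdi]
end

section
/- Let n ≥ 1. The set of signed sums {ε(1)·1 + ε(2)·2 + ⋯ + ε(n)·n : each ε(i) ∈ {−1, +1}} has exactly C(n+1,2) + 1 = n(n+1)/2 + 1 elements. -/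
theorem succ_triangle (n : ℕ) :
    (n + 1) * (n + 1 + 1) / 2 = n * (n + 1) / 2 + (n + 1) := by
  have h : (n + 1) * (n + 1 + 1) = n * (n + 1) + (n + 1) * 2 := by ring
  rw [h, Nat.add_mul_div_right _ _ two_pos]

theorem le_triangle (n : ℕ) : n ≤ n * (n + 1) / 2 := by
  cases n with
  | zero => simp
  | succ n => rw [succ_triangle]; omega

/-- The signed sums of `1, …, n` are the integers `2 * k - T` with `0 ≤ k ≤ T`, where
`T = n * (n + 1) / 2`. -/
theorem exists_signed_sum_iff (n : ℕ) (m : ℤ) :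
    (∃ ε : Fin n → ℤ, (∀ i, ε i = 1 ∨ ε i = -1) ∧ m = ∑ i, ε i * ((i : ℤ) + 1)) ↔
      ∃ k : ℕ, k ≤ n * (n + 1) / 2 ∧ m = 2 * (k : ℤ) - (n * (n + 1) / 2 : ℕ) := by
  induction n generalizing m with
  | zero => simp
  | succ n ih =>
    rw [succ_triangle]
    have hT := le_triangle n
    generalize n * (n + 1) / 2 = T at ih hT ⊢
    constructor
    · rintro ⟨ε, hε, rfl⟩
      obtain ⟨k, hk, hsum⟩ := (ih _).1 ⟨fun i => ε i.castSucc, fun i => hε _, rfl⟩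
      simp only [Fin.sum_univ_castSucc, Fin.val_castSucc, Fin.val_last, hsum]
      rcases hε (Fin.last n) with h | h
      · exact ⟨k + (n + 1), by omega, by rw [h]; push_cast; ring⟩
      · exact ⟨k, by omega, by rw [h]; push_cast; ring⟩
    · rintro ⟨k, hk, rfl⟩
      obtain ⟨s, hs, j, hj, hkj⟩ : ∃ s : ℤ, (s = 1 ∨ s = -1) ∧ ∃ j : ℕ, j ≤ T ∧
          2 * (k : ℤ) - (T + (n + 1) : ℕ) = 2 * (j : ℤ) - T + s * ((n : ℤ) + 1) := by
        rcases le_or_gt k T with h | h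
        · exact ⟨-1, Or.inr rfl, k, h, by push_cast; ring⟩
        · exact ⟨1, Or.inl rfl, k - (n + 1), by omega, by omega⟩
      obtain ⟨ε, hε, hsum⟩ := (ih _).2 ⟨j, hj, rfl⟩
      refine ⟨Fin.snoc (α := fun _ => ℤ) ε s, fun i => ?_, ?_⟩
      · induction i using Fin.lastCases with
        | last => simpa using hs
        | cast i => simpa using hε i
      · simp only [Fin.sum_univ_castSucc, Fin.snoc_castSucc, Fin.snoc_last, Fin.val_castSucc,
          Fin.val_last, ← hsum, hkj]

theorem card_signed_sums (n : ℕ) (hn : 1 ≤ n) :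
    {m : ℤ | ∃ ε : Fin n → ℤ, (∀ i, ε i = 1 ∨ ε i = -1) ∧
        m = ∑ i, ε i * ((i : ℤ) + 1)}.ncard = n * (n + 1) / 2 + 1 := by
  simp only [exists_signed_sum_iff]
  generalize n * (n + 1) / 2 = T
  have himage : {m : ℤ | ∃ k : ℕ, k ≤ T ∧ m = 2 * (k : ℤ) - T} =
      (fun k : ℕ => 2 * (k : ℤ) - T) '' (Finset.range (T + 1) : Set ℕ) := by
    ext m
    simp [eq_comm]
  have hinj : Function.Injective fun k : ℕ => 2 * (k : ℤ) - T := by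
    intro a b hab
    simp only at hab
    omega
  rw [himage, Set.ncard_image_of_injective _ hinj, Set.ncard_coe_finset, Finset.card_range]
end

section
/- Let n ≥ 1, let D be the n×n quaternionic diagonal matrix with real diagonal entries 1, 2, …, n, and let Σ = {A ∈ Sp(n) : Aᴴ·D = D·A} be the critical set of the height function h_D. Then the image h_D(Σ) = {re(tr(Dᴴ·A)) : A ∈ Σ} is a finite set with exactly n(n+1)/2 + 1 elements; i.e., the Morse function h_D on Sp(n) has exactly C(n+1,2) + 1 critical levels. -/
open scoped Quaternion Matrix

theorem exists_subset_range_sum_succ_eq (n k : ℕ) (hk : k ≤ ∑ i ∈ Finset.range n, (i + 1)) :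
    ∃ s ⊆ Finset.range n, ∑ i ∈ s, (i + 1) = k := by
  induction n generalizing k with
  | zero => exact ⟨∅, by simp, by simpa [eq_comm] using hk⟩
  | succ n ih =>
    by_cases h : k ≤ ∑ i ∈ Finset.range n, (i + 1)
    · obtain ⟨s, hs, rfl⟩ := ih k h
      exact ⟨s, hs.trans (Finset.range_subset_range.2 n.le_succ), rfl⟩
    · have hn : n ≤ ∑ i ∈ Finset.range n, (i + 1) := by
        simp [Finset.sum_add_distrib]
      rw [Finset.sum_range_succ] at hk
      obtain ⟨s, hs, hsum⟩ := ih (k - (n + 1)) (by omega)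
      have hns : n ∉ s := fun h => by simpa using hs h
      refine ⟨insert n s, ?_, ?_⟩
      · rw [Finset.range_add_one]
        exact Finset.insert_subset_insert n hs
      · rw [Finset.sum_insert hns, hsum]
        omega

theorem sum_range_succ_eq_mul_div_two (n : ℕ) :
    ∑ i ∈ Finset.range n, (i + 1) = n * (n + 1) / 2 := by
  have h := Finset.sum_range_id (n + 1)
  rw [Finset.sum_range_succ'] at h
  simpa [mul_comm] using h

theorem sum_range_mul_sign (n : ℕ) {s : Finset ℕ} (hs : s ⊆ Finset.range n) :
    ∑ i ∈ Finset.range n, ((i : ℝ) + 1) * (if i ∈ s then 1 else -1) =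
      2 * ((∑ i ∈ s, (i + 1) : ℕ) : ℝ) - ((∑ i ∈ Finset.range n, (i + 1) : ℕ) : ℝ) := by
  have h : ∑ i ∈ s, ((i : ℝ) + 1) =
      ∑ i ∈ Finset.range n, if i ∈ s then ((i : ℝ) + 1) else 0 := by
    rw [← Finset.sum_filter, Finset.filter_mem_eq_inter, Finset.inter_eq_right.2 hs]
  push_cast
  rw [h, Finset.mul_sum, ← Finset.sum_sub_distrib]
  refine Finset.sum_congr rfl fun i _ => ?_
  split_ifs <;> ring

/-- A critical point of the height function defined by `D` commutes with the square of `D`. -/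
theorem mul_mul_eq_mul_mul_of_critical {R : Type*} [Semiring R] [Star R] {A D : R}
    (hA : A * star A = 1) (hAD : star A * D = D * A) : D * (D * A) = A * (D * D) := by
  have h : D * star A = A * D := by
    calc D * star A = A * (star A * D) * star A := by rw [← mul_assoc A, hA, one_mul]
      _ = A * D * (A * star A) := by rw [hAD]; simp only [mul_assoc]
      _ = A * D := by rw [hA, mul_one]
  rw [← hAD, ← mul_assoc, h, mul_assoc]

theorem Matrix.apply_eq_zero_of_critical {n : ℕ} {A : Matrix (Fin n) (Fin n) ℍ[ℝ]} {d : Fin n → ℝ}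
    (hd : ∀ i, 0 < d i) (hinj : Function.Injective d) (hA : A * Aᴴ = 1)
    (hAD : Aᴴ * Matrix.diagonal (fun i => (d i : ℍ[ℝ])) =
      Matrix.diagonal (fun i => (d i : ℍ[ℝ])) * A) {i j : Fin n} (hij : i ≠ j) : A i j = 0 := by
  have h := congrFun (congrFun (mul_mul_eq_mul_mul_of_critical (A := A) hA hAD) i) j
  rw [Matrix.diagonal_mul, Matrix.diagonal_mul, Matrix.diagonal_mul_diagonal,
    Matrix.mul_diagonal, ← Quaternion.coe_mul, ← Quaternion.coe_commutes _ (A i j), ← mul_assoc,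
    ← Quaternion.coe_mul, ← sub_eq_zero, ← sub_mul, ← Quaternion.coe_sub, mul_eq_zero] at h
  refine h.resolve_left fun h0 => hij (hinj ?_)
  have h1 : d i * d i - d j * d j = 0 :=
    Quaternion.coe_injective (h0.trans Quaternion.coe_zero.symm)
  exact (mul_self_inj (hd i).le (hd j).le).1 (sub_eq_zero.1 h1)

theorem Quaternion.re_eq_one_or_neg_one {a : ℍ[ℝ]} {d : ℝ} (hd : d ≠ 0) (ha : a * star a = 1)
    (had : star a * d = d * a) : a.re = 1 ∨ a.re = -1 := by
  rw [← Quaternion.coe_commutes] at had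
  have hs : star a = a := mul_left_cancel₀ (Quaternion.coe_injective.ne hd) had
  rw [hs] at ha
  rcases mul_self_eq_one_iff.1 ha with rfl | rfl <;> simp

theorem Matrix.re_apply_self_of_critical {n : ℕ} {A : Matrix (Fin n) (Fin n) ℍ[ℝ]} {d : Fin n → ℝ}
    (hd : ∀ i, 0 < d i) (hinj : Function.Injective d) (hA : A * Aᴴ = 1)
    (hAD : Aᴴ * Matrix.diagonal (fun i => (d i : ℍ[ℝ])) =
      Matrix.diagonal (fun i => (d i : ℍ[ℝ])) * A) (i : Fin n) :
    (A i i).re = 1 ∨ (A i i).re = -1 := by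
  refine Quaternion.re_eq_one_or_neg_one (hd i).ne' ?_ ?_
  · have h := congrFun (congrFun hA i) i
    rw [Matrix.mul_apply, Finset.sum_eq_single i (fun j _ hj => by
      rw [Matrix.apply_eq_zero_of_critical hd hinj hA hAD hj.symm, zero_mul]) (by simp)] at h
    simpa using h
  · simpa using congrFun (congrFun hAD i) i

theorem Matrix.re_trace_conjTranspose_diagonal_mul {n : ℕ} (A : Matrix (Fin n) (Fin n) ℍ[ℝ])
    (d : Fin n → ℝ) :
    ((Matrix.diagonal (fun i => (d i : ℍ[ℝ])))ᴴ * A).trace.re = ∑ i, d i * (A i i).re := by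
  have h (f : Fin n → ℍ[ℝ]) : (∑ i, f i).re = ∑ i, (f i).re :=
    map_sum (QuaternionAlgebra.reₗ (-1 : ℝ) 0 (-1)) f Finset.univ
  simp [Matrix.trace, h, Matrix.diagonal_conjTranspose, Matrix.diagonal_mul]

theorem setOf_critical_levels_eq (n : ℕ) :
    {r : ℝ | ∃ A : Matrix (Fin n) (Fin n) ℍ[ℝ], A * Aᴴ = 1 ∧
      Aᴴ * Matrix.diagonal (fun i : Fin n => (((i : ℕ) + 1 : ℝ) : ℍ[ℝ])) =
        Matrix.diagonal (fun i : Fin n => (((i : ℕ) + 1 : ℝ) : ℍ[ℝ])) * A ∧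
      r = (((Matrix.diagonal (fun i : Fin n => (((i : ℕ) + 1 : ℝ) : ℍ[ℝ])))ᴴ * A).trace).re} =
    (fun k : ℕ => 2 * (k : ℝ) - ((∑ i ∈ Finset.range n, (i + 1) : ℕ) : ℝ)) ''
      (Finset.range (∑ i ∈ Finset.range n, (i + 1) + 1) : Set ℕ) := by
  ext r
  constructor
  · rintro ⟨A, hA, hAD, rfl⟩
    have hre := Matrix.re_apply_self_of_critical (d := fun i : Fin n => ((i : ℕ) + 1 : ℝ))
      (fun i => by positivity) (fun i j h => by simpa [Fin.ext_iff] using h) hA hAD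
    let s : Finset ℕ := (Finset.univ.filter fun i : Fin n => (A i i).re = 1).map Fin.valEmbedding
    have hs : s ⊆ Finset.range n := fun i hi => by
      obtain ⟨j, -, rfl⟩ := Finset.mem_map.1 hi
      simp
    refine ⟨∑ i ∈ s, (i + 1), ?_, ?_⟩
    · simpa [Nat.lt_succ_iff] using Finset.sum_le_sum_of_subset (f := fun i => i + 1) hs
    · dsimp only
      rw [← sum_range_mul_sign n hs, Matrix.re_trace_conjTranspose_diagonal_mul _
        (fun i : Fin n => ((i : ℕ) + 1 : ℝ)), Finset.sum_range]
      refine Finset.sum_congr rfl fun i _ => ?_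
      have hi : (i : ℕ) ∈ s ↔ (A i i).re = 1 := by
        simp [s, Fin.val_inj]
      rcases hre i with h | h
      · rw [if_pos (hi.2 h), h]
      · rw [if_neg (fun h' => by linarith [hi.1 h']), h]
  · rintro ⟨k, hk, rfl⟩
    obtain ⟨s, hs, rfl⟩ := exists_subset_range_sum_succ_eq n k (by simpa [Nat.lt_succ_iff] using hk)
    refine ⟨Matrix.diagonal fun i : Fin n => if (i : ℕ) ∈ s then 1 else -1, ?_, ?_, ?_⟩
    · rw [Matrix.diagonal_conjTranspose, Matrix.diagonal_mul_diagonal, ← Matrix.diagonal_one]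
      congr 1
      ext1 i
      by_cases h : (i : ℕ) ∈ s <;> simp [h]
    · rw [Matrix.diagonal_conjTranspose, Matrix.diagonal_mul_diagonal, Matrix.diagonal_mul_diagonal]
      congr 1
      ext1 i
      by_cases h : (i : ℕ) ∈ s <;> simp [h]
    · dsimp only
      rw [← sum_range_mul_sign n hs, Matrix.re_trace_conjTranspose_diagonal_mul _
        (fun i : Fin n => ((i : ℕ) + 1 : ℝ)), Finset.sum_range]
      refine Finset.sum_congr rfl fun i _ => ?_
      by_cases h : (i : ℕ) ∈ s <;> simp [h]

theorem card_critical_levels_morse_height (n : ℕ) (hn : 1 ≤ n)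
    (D : Matrix (Fin n) (Fin n) ℍ[ℝ])
    (hD : D = Matrix.diagonal fun i : Fin n => (((i : ℕ) + 1 : ℝ) : ℍ[ℝ])) :
    {r : ℝ | ∃ A : Matrix (Fin n) (Fin n) ℍ[ℝ],
        A * Aᴴ = 1 ∧ Aᴴ * D = D * A ∧ r = ((Dᴴ * A).trace).re}.Finite ∧
    {r : ℝ | ∃ A : Matrix (Fin n) (Fin n) ℍ[ℝ],
        A * Aᴴ = 1 ∧ Aᴴ * D = D * A ∧ r = ((Dᴴ * A).trace).re}.ncard =
      n * (n + 1) / 2 + 1 := by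
  subst hD
  rw [setOf_critical_levels_eq]
  refine ⟨(Finset.finite_toSet _).image _, ?_⟩
  rw [Set.ncard_image_of_injective _ fun a b h => by simpa using h, Set.ncard_coe_finset,
    Finset.card_range, sum_range_succ_eq_mul_div_two]
end
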